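/- In the multiplier algebra M(H(b)) (with its multiplier norm), the closure of the linear span of {z^n : n ≥ 0} equals the closure of the linear span of {k_μ : μ ∈ D, |μ| < 1/‖S_b‖}. -/

import Mathlib

open MeasureTheory Complex Filter Set Metric
open scoped ComplexConjugate

noncomputable section

/-- The circle group `ℝ / 2πℤ`, parametrizing the unit circle `𝕋`. -/
instance fact_two_pi_pos : Fact (0 < 2 * Real.pi) := ⟨by positivity⟩

abbrev Tc : Type := AddCircle (2 * Real.pi)

/-- Normalized Lebesgue measure on the circle. -/
def m : Measure Tc := AddCircle.haarAddCircle

instance : IsProbabilityMeasure m := by unfold m; infer_instance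

/-- The point `e^{iθ}` of the unit circle corresponding to `θ ∈ ℝ/2πℤ`. -/
def bd (θ : Tc) : ℂ := (AddCircle.toCircle θ : ℂ)

/-- The open unit disc. -/
abbrev uDisc : Set ℂ := Metric.ball (0 : ℂ) 1

/-- A function holomorphic on the open unit disc. -/
def HolDisc (f : ℂ → ℂ) : Prop := DifferentiableOn ℂ f uDisc

/-- `F` is the radial (a.e.) boundary function of `f`. -/
def IsBdry (f : ℂ → ℂ) (F : Tc → ℂ) : Prop :=
  ∀ᵐ θ ∂m, Tendsto (fun r : ℝ => f ((r : ℂ) * bd θ)) (nhdsWithin 1 (Set.Iio 1)) (nhds (F θ))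

/-- Membership in the Hardy space `H^p` of the unit disc, `0 < p < ∞`. -/
def MemHp (p : ℝ) (f : ℂ → ℂ) : Prop :=
  HolDisc f ∧ ∃ C : ℝ, ∀ r : ℝ, 0 ≤ r → r < 1 →
    (∫ θ : Tc, ‖f ((r : ℂ) * bd θ)‖ ^ p ∂m) ≤ C

/-- Membership in `H^∞`: bounded holomorphic functions on the disc. -/
def MemHinf (f : ℂ → ℂ) : Prop := HolDisc f ∧ ∃ C : ℝ, ∀ z ∈ uDisc, ‖f z‖ ≤ C

/-- Outer functions on the unit disc. -/
def OuterFn (f : ℂ → ℂ) : Prop :=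
  HolDisc f ∧ ∃ (α : ℂ) (w : Tc → ℝ), ‖α‖ = 1 ∧ (∀ θ, 0 ≤ w θ) ∧
    Integrable (fun θ => Real.log (w θ)) m ∧
    ∀ z ∈ uDisc,
      f z = α * Complex.exp (∫ θ : Tc, ((bd θ + z) / (bd θ - z)) * (Real.log (w θ) : ℂ) ∂m)

/-- Inner functions: `Θ` holomorphic bounded by one, with unimodular boundary values `Θs`. -/
def InnerFn (Θ : ℂ → ℂ) (Θs : Tc → ℂ) : Prop :=
  HolDisc Θ ∧ (∀ z ∈ uDisc, ‖Θ z‖ ≤ 1) ∧ IsBdry Θ Θs ∧ (∀ᵐ θ ∂m, ‖Θs θ‖ = 1)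

/-- `L²(𝕋, m)`. -/
abbrev L2 : Type := Lp ℂ 2 m

/-- The Hardy space `H²`, viewed inside `L²(𝕋)` as the functions whose negative
Fourier coefficients vanish. -/
def H2 : Set L2 := {F | ∀ n : ℤ, n < 0 → fourierCoeff (F : Tc → ℂ) n = 0}

/-- The Cauchy kernel `k_λ(z) = 1/(1 - conj(λ) z)`. -/
def ker (lam z : ℂ) : ℂ := (1 - conj lam * z)⁻¹

/-- Divergence of `Σ (1 - |λ_n|)` (for `λ_n` in the unit disc this is the negation of
the Blaschke condition). -/
def NotBlaschke (lam : ℕ → ℂ) : Prop := ¬ Summable (fun n => 1 - ‖lam n‖)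

/-- A bundle recording: a non-constant function `b` in the closed unit ball of `H^∞`
with `log(1 - |b|) ∈ L¹(𝕋)`, its Pythagorean mate `a` (outer, `a(0) > 0`,
`|a|² + |b|² = 1` a.e.), together with their boundary functions `bs`, `as'`. -/
structure BPair where
  b : ℂ → ℂ
  a : ℂ → ℂ
  bs : Tc → ℂ
  as' : Tc → ℂ
  b_hol : HolDisc b
  b_le_one : ∀ z ∈ uDisc, ‖b z‖ ≤ 1
  b_nonconst : ¬ ∃ c : ℂ, ∀ z ∈ uDisc, b z = c
  b_bdry : IsBdry b bs
  log_int : Integrable (fun θ => Real.log (1 - ‖bs θ‖)) m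
  a_outer : OuterFn a
  a_bdry : IsBdry a as'
  a0_pos : ∃ r : ℝ, 0 < r ∧ a 0 = (r : ℂ)
  pyth : ∀ᵐ θ ∂m, ‖as' θ‖ ^ 2 + ‖bs θ‖ ^ 2 = 1

/-- The defining relation of `H(b)`: `T_{conj b} F = T_{conj a} F⁺`, i.e. all nonnegative
Fourier coefficients of `conj(b)·F - conj(a)·F⁺` vanish, with `F, F⁺ ∈ H²`. -/
def HbMem (P : BPair) (F Fp : L2) : Prop :=
  F ∈ H2 ∧ Fp ∈ H2 ∧ ∀ n : ℤ, 0 ≤ n →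
    fourierCoeff (fun θ => conj (P.bs θ) * (F : Tc → ℂ) θ - conj (P.as' θ) * (Fp : Tc → ℂ) θ) n = 0

/-- The ambient Hilbert space `L² ×_2 L²` in which `H(b)` embeds isometrically via
`f ↦ (f, f⁺)`; its norm is `‖(F, F⁺)‖² = ‖F‖₂² + ‖F⁺‖₂²`, the `H(b)` norm. -/
abbrev HbP : Type := WithLp 2 (L2 × L2)

def fst2 (p : HbP) : L2 := ((WithLp.equiv 2 (L2 × L2)) p).1
def snd2 (p : HbP) : L2 := ((WithLp.equiv 2 (L2 × L2)) p).2

/-- The de Branges–Rovnyak space `H(b)`, as the set of pairs `(f, f⁺)`. -/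
def HbSet (P : BPair) : Set HbP := {p | HbMem P (fst2 p) (snd2 p)}

/-- `q` represents the element `φ · f` of `H(b)`, where `p` represents `f` and `φs` is a
boundary function: `q ∈ H(b)` and the first component of `q` is `φs` times that of `p`. -/
def MulRep (P : BPair) (φs : Tc → ℂ) (p q : HbP) : Prop :=
  q ∈ HbSet P ∧ (fst2 q : Tc → ℂ) =ᵐ[m] fun θ => φs θ * (fst2 p : Tc → ℂ) θ

/-- `Zf` is the family of elements `z^n·f`, `n ≥ 0`, of `H(b)`, where `p` represents `f`. -/
def ZFamily (P : BPair) (p : HbP) (Zf : ℕ → HbP) : Prop :=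
  ∀ n : ℕ, MulRep P (fun θ => (bd θ) ^ n) p (Zf n)

/-- `f` (represented by the pair `p`) is cyclic for `S_b`: the linear span of
`{z^n f : n ≥ 0}` is dense in `H(b)`. -/
def CyclicSb (P : BPair) (p : HbP) : Prop :=
  p ∈ HbSet P ∧ ∀ Zf : ℕ → HbP, ZFamily P p Zf →
    closure (↑(Submodule.span ℂ (Set.range Zf)) : Set HbP) = HbSet P

/-- `FK` is the family of elements `f·k_{λ_n}`, `n ≥ 0`, of `H(b)`. -/
def KFamily (P : BPair) (lam : ℕ → ℂ) (p : HbP) (FK : ℕ → HbP) : Prop :=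
  ∀ n : ℕ, MulRep P (fun θ => ker (lam n) (bd θ)) p (FK n)

/-- `C` is a bound for the norm of the shift `S_b` on `H(b)`. -/
def ShiftBound (P : BPair) (C : ℝ) : Prop :=
  0 ≤ C ∧ ∀ p q : HbP, p ∈ HbSet P → MulRep P (fun θ => bd θ) p q → ‖q‖ ≤ C * ‖p‖

/-- `N = ‖S_b‖`, the operator norm of the shift on `H(b)`. -/
def IsShiftNorm (P : BPair) (N : ℝ) : Prop :=
  ShiftBound P N ∧ ∀ C : ℝ, ShiftBound P C → N ≤ C

/-- `μ` is the Aleksandrov–Clark measure `μ_α` of `b`. -/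
def IsACMeasure (P : BPair) (α : ℂ) (μ : Measure Tc) : Prop :=
  IsFiniteMeasure μ ∧ ∀ z ∈ uDisc,
    (1 - ‖P.b z‖ ^ 2) / ‖1 - conj α * P.b z‖ ^ 2 = ∫ θ : Tc, (1 - ‖z‖ ^ 2) / ‖z - bd θ‖ ^ 2 ∂μ


/-- The multiplication operator (by a function with boundary values `φs`) has norm `≤ C`
as an operator on `H(b)`. -/
def MultNormLe (P : BPair) (φs : Tc → ℂ) (C : ℝ) : Prop :=
  ∀ p q : HbP, p ∈ HbSet P → MulRep P φs p q → ‖q‖ ≤ C * ‖p‖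

/-- `φ` (with boundary function `φs`) is a multiplier of `H(b)`. -/
def IsMult (P : BPair) (φ : ℂ → ℂ) (φs : Tc → ℂ) : Prop :=
  HolDisc φ ∧ IsBdry φ φs ∧ ∀ p ∈ HbSet P, ∃ q : HbP, MulRep P φs p q

/-- `ψ` belongs to the closure, in the multiplier norm of `M(H(b))`, of the linear span
of the set `S` of (boundary functions of) multipliers. -/
def InMultClosure (P : BPair) (S : Set (Tc → ℂ)) (ψ : Tc → ℂ) : Prop :=
  ∀ ε : ℝ, 0 < ε → ∃ g ∈ Submodule.span ℂ S, MultNormLe P (ψ - g) ε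

lemma bd_norm (θ : Tc) : ‖bd θ‖ = 1 := Circle.norm_coe _

lemma bd_cont : Continuous bd := by
  unfold bd
  exact continuous_subtype_val.comp AddCircle.continuous_toCircle

lemma bd_coe (x : ℝ) : bd (x : Tc) = circleMap 0 1 x := by
  simp only [bd, AddCircle.toCircle_apply_mk, Circle.coe_exp, circleMap]
  simp

lemma fourier_bd (n : ℕ) (θ : Tc) : fourier (n : ℤ) θ = bd θ ^ n := by
  simp [fourier_apply, bd, AddCircle.toCircle_nsmul]

lemma fourier_bd_neg (n : ℕ) (θ : Tc) : fourier (-(n : ℤ)) θ = conj (bd θ ^ n) := by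
  rw [fourier_neg, fourier_bd]

lemma circAvg {E : Type*} [NormedAddCommGroup E] [NormedSpace ℝ E] (f : ℂ → E) :
    ∫ θ : Tc, f (bd θ) ∂m = Real.circleAverage f 0 1 := by
  rw [m, AddCircle.integral_haarAddCircle, Real.circleAverage_def]
  congr 1
  rw [← AddCircle.intervalIntegral_preimage (2 * Real.pi) 0]
  simp only [bd_coe, zero_add]

def PK (r : ℝ) (θ t : Tc) : ℝ := poissonKernel 0 ((r : ℂ) * bd θ) (bd t)

lemma rbd_mem {r : ℝ} (h0 : 0 ≤ r) (h1 : r < 1) (θ : Tc) : (r : ℂ) * bd θ ∈ uDisc := by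
  simp [bd_norm, abs_of_nonneg h0, h1]

lemma PK_eq (r : ℝ) (θ t : Tc) : PK r θ t = (1 - r ^ 2) / ‖bd t - r * bd θ‖ ^ 2 := by
  simp [PK, poissonKernel, bd_norm]

lemma PK_re (r : ℝ) (θ t : Tc) :
    PK r θ t = ((bd t + r * bd θ) / (bd t - r * bd θ)).re := by
  rw [PK, poissonKernel_eq_re_herglotzRieszKernel]
  simp [herglotzRieszKernel]

lemma sub_ne {r : ℝ} (h0 : 0 ≤ r) (h1 : r < 1) (θ t : Tc) : bd t - r * bd θ ≠ 0 := by
  intro h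
  have h2 := congrArg norm (sub_eq_zero.1 h)
  simp [bd_norm, abs_of_nonneg h0] at h2
  linarith

lemma PK_nonneg {r : ℝ} (h0 : 0 ≤ r) (h1 : r < 1) (θ t : Tc) : 0 ≤ PK r θ t := by
  rw [PK_eq]
  have : r ^ 2 ≤ 1 := by nlinarith
  exact div_nonneg (by linarith) (by positivity)

lemma PK_symm (r : ℝ) (θ t : Tc) : PK r θ t = PK r t θ := by
  rw [PK_eq, PK_eq]
  congr 2
  have e1 : bd t - r * bd θ = bd t * bd θ * (conj (bd θ) - r * conj (bd t)) := by
    have a1 : bd θ * conj (bd θ) = 1 := by rw [Complex.mul_conj, Complex.normSq_eq_norm_sq]; simp [bd_norm]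
    have a2 : bd t * conj (bd t) = 1 := by rw [Complex.mul_conj, Complex.normSq_eq_norm_sq]; simp [bd_norm]
    linear_combination (- bd t) * a1 + r * bd θ * a2
  rw [e1, norm_mul, norm_mul, bd_norm, bd_norm]
  have : conj (bd θ) - r * conj (bd t) = conj (bd θ - r * bd t) := by simp
  rw [this, Complex.norm_conj]; simp

lemma PK_cont {r : ℝ} (h0 : 0 ≤ r) (h1 : r < 1) : Continuous (fun x : Tc × Tc => PK r x.1 x.2) := by
  simp only [PK_eq]
  have := bd_cont
  refine Continuous.div (by fun_prop) (by fun_prop) ?_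
  intro x
  have := sub_ne h0 h1 x.1 x.2
  positivity

lemma PK_bound {r : ℝ} (h0 : 0 ≤ r) (h1 : r < 1) : ∃ C, ∀ θ t, |PK r θ t| ≤ C := by
  obtain ⟨C, hC⟩ := isCompact_univ.exists_bound_of_continuousOn (PK_cont h0 h1).continuousOn
  exact ⟨C, fun θ t => hC (θ, t) (mem_univ _)⟩

lemma PK_pow {r : ℝ} (h0 : 0 ≤ r) (h1 : r < 1) (θ : Tc) (n : ℕ) :
    ∫ t, (PK r θ t : ℂ) * bd t ^ n ∂m = (r * bd θ) ^ n := by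
  have := DiffContOnCl.circleAverage_poissonKernel_smul (f := fun z : ℂ => z ^ n) (c := 0) (R := 1)
    (Differentiable.diffContOnCl (by fun_prop)) (rbd_mem h0 h1 θ)
  rw [← this, ← circAvg]
  simp [PK]

lemma PK_pow_neg {r : ℝ} (h0 : 0 ≤ r) (h1 : r < 1) (θ : Tc) (n : ℕ) :
    ∫ t, (PK r θ t : ℂ) * conj (bd t ^ n) ∂m = conj ((r * bd θ) ^ n) := by
  rw [← PK_pow h0 h1, ← integral_conj]
  simp

lemma PK_one {r : ℝ} (h0 : 0 ≤ r) (h1 : r < 1) (θ : Tc) : ∫ t, PK r θ t ∂m = 1 := by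
  have := PK_pow h0 h1 θ 0
  simp only [pow_zero, mul_one] at this
  rw [integral_complex_ofReal] at this
  exact_mod_cast this

lemma PK_one' {r : ℝ} (h0 : 0 ≤ r) (h1 : r < 1) (t : Tc) : ∫ θ, PK r θ t ∂m = 1 := by
  simp_rw [PK_symm r _ t]
  exact PK_one h0 h1 t

def PI (r : ℝ) (u : Tc → ℂ) (θ : Tc) : ℂ := ∫ t, (PK r θ t : ℂ) * u t ∂m

lemma PI_int2 {r : ℝ} (h0 : 0 ≤ r) (h1 : r < 1) {u : Tc → ℂ} (hu : Integrable u m) :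
    Integrable (fun x : Tc × Tc => (PK r x.1 x.2 : ℂ) * u x.2) (m.prod m) := by
  obtain ⟨C, hC⟩ := PK_bound h0 h1
  refine Integrable.bdd_mul (c := C) (hu.comp_snd m) ?_ ?_
  · exact (Complex.continuous_ofReal.comp (PK_cont h0 h1)).aestronglyMeasurable
  · exact Eventually.of_forall fun x => by simpa using hC x.1 x.2

lemma PK_int1 {r : ℝ} (h0 : 0 ≤ r) (h1 : r < 1) (θ : Tc) {u : Tc → ℂ} (hu : Integrable u m) :
    Integrable (fun t => (PK r θ t : ℂ) * u t) m := by
  obtain ⟨C, hC⟩ := PK_bound h0 h1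
  refine Integrable.bdd_mul (c := C) hu ?_ ?_
  · exact (Complex.continuous_ofReal.comp ((PK_cont h0 h1).comp (by fun_prop : Continuous fun t : Tc => (θ, t)))).aestronglyMeasurable
  · exact Eventually.of_forall fun x => by simpa using hC θ x

lemma PI_int {r : ℝ} (h0 : 0 ≤ r) (h1 : r < 1) {u : Tc → ℂ} (hu : Integrable u m) :
    Integrable (PI r u) m := (PI_int2 h0 h1 hu).integral_prod_left

lemma PI_contr {r : ℝ} (h0 : 0 ≤ r) (h1 : r < 1) {u : Tc → ℂ} (hu : Integrable u m) :
    ∫ θ, ‖PI r u θ‖ ∂m ≤ ∫ t, ‖u t‖ ∂m := by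
  have hi := (PI_int2 h0 h1 hu).norm
  calc ∫ θ, ‖PI r u θ‖ ∂m ≤ ∫ θ, ∫ t, ‖(PK r θ t : ℂ) * u t‖ ∂m ∂m := by
        refine integral_mono (PI_int h0 h1 hu).norm hi.integral_prod_left fun θ => ?_
        exact norm_integral_le_integral_norm _
    _ = ∫ t, ∫ θ, ‖(PK r θ t : ℂ) * u t‖ ∂m ∂m := integral_integral_swap hi
    _ = ∫ t, ‖u t‖ ∂m := by
        congr 1; ext t
        simp only [norm_mul, Complex.norm_real, Real.norm_eq_abs, abs_of_nonneg (PK_nonneg h0 h1 _ _)]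
        rw [integral_mul_const, PK_one' h0 h1, one_mul]

lemma PI_add {r : ℝ} (h0 : 0 ≤ r) (h1 : r < 1) {u v : Tc → ℂ} (hu : Integrable u m)
    (hv : Integrable v m) (θ : Tc) : PI r (u + v) θ = PI r u θ + PI r v θ := by
  simp only [PI, Pi.add_apply, mul_add]
  exact integral_add (PK_int1 h0 h1 θ hu) (PK_int1 h0 h1 θ hv)

lemma PI_smul (r : ℝ) (c : ℂ) (u : Tc → ℂ) (θ : Tc) : PI r (c • u) θ = c * PI r u θ := by
  simp only [PI, Pi.smul_apply, smul_eq_mul]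
  rw [← integral_const_mul]
  congr 1; ext t; ring

lemma PI_congr (r : ℝ) {u v : Tc → ℂ} (h : u =ᵐ[m] v) (θ : Tc) : PI r u θ = PI r v θ := by
  refine integral_congr_ae ?_
  filter_upwards [h] with t ht
  rw [ht]

def L1conv (u : Tc → ℂ) : Prop :=
  Tendsto (fun r : ℝ => ∫ θ, ‖PI r u θ - u θ‖ ∂m) (nhdsWithin 1 (Set.Iio 1)) (nhds 0)

lemma ev_r : ∀ᶠ r : ℝ in nhdsWithin 1 (Set.Iio 1), 0 ≤ r ∧ r < 1 := by
  filter_upwards [self_mem_nhdsWithin, mem_nhdsWithin_of_mem_nhds (lt_mem_nhds (zero_lt_one))] with r h1 h2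
  exact ⟨le_of_lt h2, h1⟩

lemma L1conv_fourier (n : ℤ) : L1conv (fourier n) := by
  obtain ⟨k, hk⟩ : ∃ k : ℕ, ∀ r : ℝ, 0 ≤ r → r < 1 → ∀ θ : Tc, ‖PI r (fourier n) θ - fourier n θ‖ = |r ^ k - 1| := by
    obtain ⟨k, rfl | rfl⟩ := n.eq_nat_or_neg
    · refine ⟨k, fun r h0 h1 θ => ?_⟩
      simp only [PI, fourier_bd]
      rw [PK_pow h0 h1]
      have : ((r : ℂ) * bd θ) ^ k - bd θ ^ k = ((r ^ k - 1 : ℝ) : ℂ) * bd θ ^ k := by push_cast; ring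
      rw [this, norm_mul, norm_pow, bd_norm, Complex.norm_real]; simp
    · refine ⟨k, fun r h0 h1 θ => ?_⟩
      simp only [PI, fourier_bd_neg]
      rw [PK_pow_neg h0 h1, ← map_sub, Complex.norm_conj]
      have : ((r : ℂ) * bd θ) ^ k - bd θ ^ k = ((r ^ k - 1 : ℝ) : ℂ) * bd θ ^ k := by push_cast; ring
      rw [this, norm_mul, norm_pow, bd_norm, Complex.norm_real]; simp
  have : Tendsto (fun r : ℝ => |r ^ k - 1|) (nhdsWithin 1 (Set.Iio 1)) (nhds 0) := by
    have : Continuous (fun r : ℝ => |r ^ k - 1|) := by fun_prop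
    have := this.tendsto 1
    simp only [one_pow, sub_self, abs_zero] at this
    exact this.mono_left nhdsWithin_le_nhds
  refine this.congr' ?_
  filter_upwards [ev_r] with r hr
  simp only [hk r hr.1 hr.2]
  simp

lemma L1conv_congr {u v : Tc → ℂ} (h : u =ᵐ[m] v) (hu : L1conv u) : L1conv v := by
  refine hu.congr fun r => ?_
  refine integral_congr_ae ?_
  filter_upwards [h] with θ hθ
  rw [PI_congr r h, hθ]

lemma PIsub_int {r : ℝ} (h0 : 0 ≤ r) (h1 : r < 1) {u : Tc → ℂ} (hu : Integrable u m) :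
    Integrable (fun θ => ‖PI r u θ - u θ‖) m := ((PI_int h0 h1 hu).sub hu).norm

lemma L1conv_add {u v : Tc → ℂ} (iu : Integrable u m) (iv : Integrable v m)
    (hu : L1conv u) (hv : L1conv v) : L1conv (u + v) := by
  have := Tendsto.add hu hv
  rw [add_zero] at this
  refine squeeze_zero' (Eventually.of_forall fun r => by positivity) ?_ this
  filter_upwards [ev_r] with r hr
  rw [← integral_add (PIsub_int hr.1 hr.2 iu) (PIsub_int hr.1 hr.2 iv)]
  have iuv := iu.add iv
  refine integral_mono (PIsub_int hr.1 hr.2 iuv) ((PIsub_int hr.1 hr.2 iu).add (PIsub_int hr.1 hr.2 iv)) fun θ => ?_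
  simp only [PI_add hr.1 hr.2 iu iv, Pi.add_apply]
  refine le_trans (le_of_eq ?_) (norm_add_le _ _)
  congr 1; ring

lemma L1conv_smul {u : Tc → ℂ} (c : ℂ) (hu : L1conv u) : L1conv (c • u) := by
  have := Tendsto.const_mul ‖c‖ hu
  rw [mul_zero] at this
  refine this.congr fun r => ?_
  rw [← integral_const_mul]
  congr 1; ext θ
  rw [PI_smul, Pi.smul_apply, smul_eq_mul, ← mul_sub, norm_mul]

def fl1 (n : ℤ) : Lp ℂ 1 m := fourierLp 1 n

lemma L1_dense : (Submodule.span ℂ (Set.range fl1)).topologicalClosure = ⊤ :=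
  span_fourierLp_closure_eq_top (by simp)

lemma L1conv_all {u : Tc → ℂ} (iu : Integrable u m) : L1conv u := by
  have hspan : ∀ G ∈ Submodule.span ℂ (Set.range fl1), L1conv (G : Tc → ℂ) := by
    intro G hG
    induction hG using Submodule.span_induction with
    | mem x hx =>
      obtain ⟨n, rfl⟩ := hx
      exact L1conv_congr (coeFn_fourierLp 1 n).symm (L1conv_fourier n)
    | zero =>
      refine L1conv_congr (Lp.coeFn_zero _ _ _).symm ?_
      have := L1conv_smul 0 (L1conv_fourier 0)
      simpa using this
    | add x y _ _ hx hy =>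
      exact L1conv_congr (Lp.coeFn_add _ _).symm (L1conv_add (L1.integrable_coeFn x) (L1.integrable_coeFn y) hx hy)
    | smul c x _ hx =>
      exact L1conv_congr (Lp.coeFn_smul _ _).symm (L1conv_smul c hx)
  rw [L1conv, Metric.tendsto_nhds]
  intro ε hε
  have hU : iu.toL1 u ∈ (Submodule.span ℂ (Set.range fl1)).topologicalClosure := by
    rw [L1_dense]; trivial
  obtain ⟨G, hG, hd⟩ := Metric.mem_closure_iff.1 hU (ε / 3) (by linarith)
  have iG : Integrable (G : Tc → ℂ) m := L1.integrable_coeFn G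
  set w : Tc → ℂ := u - (G : Tc → ℂ) with hw
  have iw : Integrable w m := iu.sub iG
  have hwn : ∫ t, ‖w t‖ ∂m < ε / 3 := by
    rw [dist_eq_norm, L1.norm_eq_integral_norm] at hd
    convert hd using 1
    refine integral_congr_ae ?_
    filter_upwards [Lp.coeFn_sub (iu.toL1 u) G, iu.coeFn_toL1] with t h1 h2
    rw [h1, hw, Pi.sub_apply, Pi.sub_apply, h2]
  have hGc := hspan G hG
  rw [L1conv, Metric.tendsto_nhds] at hGc
  filter_upwards [ev_r, hGc (ε / 3) (by linarith)] with r hr hGr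
  have hnn : ∀ v : Tc → ℂ, 0 ≤ ∫ θ, ‖PI r v θ - v θ‖ ∂m := fun v => by positivity
  rw [Real.dist_eq, sub_zero, abs_of_nonneg (hnn _)] at hGr ⊢
  have key : ∫ θ, ‖PI r u θ - u θ‖ ∂m ≤ ∫ θ, (‖PI r w θ‖ + ‖w θ‖ + ‖PI r G θ - G θ‖) ∂m := by
    have i1 := (PI_int hr.1 hr.2 iw).norm
    have i2 := (PIsub_int hr.1 hr.2 iG)
    refine integral_mono (PIsub_int hr.1 hr.2 iu) ((i1.add iw.norm).add i2) fun θ => ?_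
    have : PI r u θ = PI r w θ + PI r G θ := by
      rw [← PI_add hr.1 hr.2 iw iG]; congr 1; simp [hw]
    have e : PI r u θ - u θ = (PI r w θ - w θ) + (PI r G θ - G θ) := by
      rw [this, hw, Pi.sub_apply]; ring
    dsimp only
    rw [e]
    exact (norm_add_le _ _).trans (add_le_add (norm_sub_le _ _) le_rfl)
  rw [integral_add (f := fun θ => ‖PI r w θ‖ + ‖w θ‖) ((PI_int hr.1 hr.2 iw).norm.add iw.norm) (PIsub_int hr.1 hr.2 iG),
    integral_add (PI_int hr.1 hr.2 iw).norm iw.norm] at key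
  have := PI_contr hr.1 hr.2 iw
  linarith

def rs (n : ℕ) : ℝ := 1 - 1 / ((n : ℝ) + 1)

lemma rs_mem (n : ℕ) : 0 ≤ rs n ∧ rs n < 1 := by
  have h : (0 : ℝ) < (n : ℝ) + 1 := by positivity
  have h2 : 1 / ((n : ℝ) + 1) ≤ 1 := by
    rw [div_le_one h]; linarith [(Nat.cast_nonneg n : (0 : ℝ) ≤ n)]
  have h3 : 0 < 1 / ((n : ℝ) + 1) := by positivity
  constructor <;> unfold rs <;> linarith

lemma rs_tendsto : Tendsto rs atTop (nhdsWithin 1 (Set.Iio 1)) := by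
  refine tendsto_nhdsWithin_iff.2 ⟨?_, Eventually.of_forall fun n => (rs_mem n).2⟩
  have := (tendsto_one_div_add_atTop_nhds_zero_nat (𝕜 := ℝ)).const_sub 1
  rw [sub_zero] at this
  exact this

lemma rad_cont {f : ℂ → ℂ} (hf : HolDisc f) {r : ℝ} (h0 : 0 ≤ r) (h1 : r < 1) :
    Continuous (fun θ : Tc => f (r * bd θ)) := by
  have := bd_cont
  exact hf.continuousOn.comp_continuous (by fun_prop) (fun θ => rbd_mem h0 h1 θ)

lemma bdry_meas {f : ℂ → ℂ} {F : Tc → ℂ} (hf : HolDisc f) (h : IsBdry f F) :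
    AEStronglyMeasurable F m := by
  refine aestronglyMeasurable_of_tendsto_ae atTop (f := fun n θ => f (rs n * bd θ)) ?_ ?_
  · exact fun n => (rad_cont hf (rs_mem n).1 (rs_mem n).2).aestronglyMeasurable
  · filter_upwards [h] with θ hθ
    exact hθ.comp rs_tendsto

lemma coeff_bdry {f : ℂ → ℂ} {F : Tc → ℂ} (hf : HolDisc f) (h : IsBdry f F)
    (hb : ∀ r : ℝ, 0 ≤ r → r < 1 → ∀ θ, ‖f (r * bd θ)‖ ≤ 1) (n : ℕ) :
    ∫ θ, bd θ ^ n * F θ ∂m = 0 ^ n * f 0 := by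
  have h1 : Tendsto (fun k => ∫ θ, bd θ ^ n * f (rs k * bd θ) ∂m) atTop
      (nhds (∫ θ, bd θ ^ n * F θ ∂m)) := by
    refine tendsto_integral_of_dominated_convergence (fun _ => (1 : ℝ)) ?_ (integrable_const _) ?_ ?_
    · exact fun k => ((bd_cont.pow n).mul (rad_cont hf (rs_mem k).1 (rs_mem k).2)).aestronglyMeasurable
    · intro k
      refine Eventually.of_forall fun θ => ?_
      rw [norm_mul, norm_pow, bd_norm, one_pow, one_mul]
      exact hb _ (rs_mem k).1 (rs_mem k).2 θ
    · filter_upwards [h] with θ hθ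
      exact (hθ.comp rs_tendsto).const_mul _
  refine tendsto_nhds_unique h1 (tendsto_const_nhds.congr fun k => ?_)
  rw [circAvg (fun z => z ^ n * f (rs k * z))]
  rw [DiffContOnCl.circleAverage]
  · simp
  · rw [abs_one]
    refine DifferentiableOn.diffContOnCl ?_
    rw [closure_ball _ (by norm_num)]
    refine DifferentiableOn.mul (by fun_prop) ?_
    refine hf.comp (by fun_prop) ?_
    intro z hz
    have hz' : ‖z‖ ≤ 1 := by simpa using hz
    have h2 := rs_mem k
    simp only [mem_ball, dist_zero_right, norm_mul, Complex.norm_real, Real.norm_eq_abs, abs_of_nonneg h2.1]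
    nlinarith

lemma outer_bound {a : ℂ → ℂ} {as' : Tc → ℂ} (ha : OuterFn a) (hb : IsBdry a as')
    (h1 : ∀ᵐ θ ∂m, ‖as' θ‖ ≤ 1) : ∀ r : ℝ, 0 ≤ r → r < 1 → ∀ θ, ‖a (r * bd θ)‖ ≤ 1 := by
  obtain ⟨hol, α, w, hα, -, hw, hform⟩ := ha
  set u : Tc → ℝ := fun θ => Real.log (w θ) with hu
  have iuc : Integrable (fun θ => (u θ : ℂ)) m := hw.ofReal
  have hnorm : ∀ r : ℝ, 0 ≤ r → r < 1 → ∀ θ,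
      ‖a (r * bd θ)‖ = Real.exp (∫ t, PK r θ t * u t ∂m) := by
    intro r h0 h1 θ
    rw [hform _ (rbd_mem h0 h1 θ), norm_mul, hα, one_mul, Complex.norm_exp]
    congr 1
    have hi : Integrable (fun t => ((bd t + r * bd θ) / (bd t - r * bd θ)) * (u t : ℂ)) m := by
      have hc : Continuous (fun t => (bd t + r * bd θ) / (bd t - r * bd θ)) := by
        have := bd_cont
        exact Continuous.div (by fun_prop) (by fun_prop) (fun t => sub_ne h0 h1 θ t)
      obtain ⟨C, hC⟩ := isCompact_univ.exists_bound_of_continuousOn hc.continuousOn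
      exact Integrable.bdd_mul (c := C) iuc hc.aestronglyMeasurable
        (Eventually.of_forall fun t => hC t (mem_univ _))
    rw [← RCLike.re_eq_complex_re, ← integral_re hi]
    congr 1; ext t
    rw [RCLike.re_eq_complex_re, Complex.re_mul_ofReal, PK_re]
  have hPI : ∀ r θ, PI r (fun θ => (u θ : ℂ)) θ = ((∫ t, PK r θ t * u t ∂m : ℝ) : ℂ) := by
    intro r θ
    rw [PI, ← integral_complex_ofReal]
    congr 1; ext t; push_cast; rfl
  have hu0 : ∀ᵐ θ ∂m, u θ ≤ 0 := by
    have hL := (L1conv_all iuc).comp rs_tendsto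
    have hM : TendstoInMeasure m (fun n => PI (rs n) (fun θ => (u θ : ℂ))) atTop (fun θ => (u θ : ℂ)) := by
      refine tendstoInMeasure_of_tendsto_eLpNorm (p := 1) one_ne_zero ?_ iuc.aestronglyMeasurable ?_
      · exact fun n => (PI_int (rs_mem n).1 (rs_mem n).2 iuc).aestronglyMeasurable
      · have e : ∀ n, eLpNorm (PI (rs n) (fun θ => (u θ : ℂ)) - fun θ => (u θ : ℂ)) 1 m
            = ENNReal.ofReal (∫ θ, ‖PI (rs n) (fun θ => (u θ : ℂ)) θ - u θ‖ ∂m) := by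
          intro n
          have hi := (PI_int (rs_mem n).1 (rs_mem n).2 iuc).sub iuc
          rw [eLpNorm_one_eq_lintegral_enorm]
          exact (ofReal_integral_norm_eq_lintegral_enorm hi).symm
        simp_rw [e]
        rw [← ENNReal.ofReal_zero]
        exact (ENNReal.continuous_ofReal.tendsto 0).comp hL
    obtain ⟨ns, hns, hae⟩ := hM.exists_seq_tendsto_ae
    filter_upwards [hae, hb, h1] with θ t1 t2 t3
    have t4 := (t2.comp (rs_tendsto.comp hns.tendsto_atTop)).norm
    have t5 := (Real.continuous_exp.tendsto _).comp ((Complex.continuous_re.tendsto _).comp t1)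
    have : Real.exp (u θ) = ‖as' θ‖ := by
      refine tendsto_nhds_unique t5 (t4.congr fun k => ?_)
      simp only [Function.comp]
      rw [hnorm _ (rs_mem _).1 (rs_mem _).2, hPI, Complex.ofReal_re]
    rw [← Real.exp_le_one_iff, this]; exact t3
  intro r h0 h1 θ
  rw [hnorm r h0 h1, Real.exp_le_one_iff]
  refine integral_nonpos_of_ae ?_
  filter_upwards [hu0] with t ht
  exact mul_nonpos_of_nonneg_of_nonpos (PK_nonneg h0 h1 θ t) ht

lemma as_le (P : BPair) : ∀ᵐ θ ∂m, ‖P.as' θ‖ ≤ 1 := by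
  filter_upwards [P.pyth] with θ h
  nlinarith [norm_nonneg (P.as' θ), sq_nonneg ‖P.bs θ‖]

lemma bs_le (P : BPair) : ∀ᵐ θ ∂m, ‖P.bs θ‖ ≤ 1 := by
  filter_upwards [P.pyth] with θ h
  nlinarith [norm_nonneg (P.bs θ), sq_nonneg ‖P.as' θ‖]

lemma as_meas (P : BPair) : AEStronglyMeasurable P.as' m := bdry_meas P.a_outer.1 P.a_bdry
lemma bs_meas (P : BPair) : AEStronglyMeasurable P.bs m := bdry_meas P.b_hol P.b_bdry

lemma as_coeff (P : BPair) (n : ℕ) : ∫ θ, bd θ ^ n * P.as' θ ∂m = 0 ^ n * P.a 0 :=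
  coeff_bdry P.a_outer.1 P.a_bdry (outer_bound P.a_outer P.a_bdry (as_le P)) n

lemma as_fc (P : BPair) (n : ℕ) :
    fourierCoeff (fun θ => conj (P.as' θ)) (n : ℤ) = conj (0 ^ n * P.a 0) := by
  rw [← as_coeff, ← integral_conj]
  unfold fourierCoeff
  change ∫ t, _ ∂m = _
  congr 1; ext t
  rw [fourier_bd_neg, smul_eq_mul, map_mul]

lemma resolvent_lim {B : Type*} [NormedRing B] [NormedAlgebra ℂ B] [CompleteSpace B] (S : B) :
    Tendsto (fun c : ℂ => Ring.inverse (1 - c • S)) (nhdsWithin 0 {0}ᶜ) (nhds 1) := by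
  have h1 : ContinuousAt (fun c : ℂ => Ring.inverse (1 - c • S)) 0 := by
    refine ContinuousAt.comp (g := Ring.inverse) ?_ (by fun_prop)
    have := NormedRing.inverse_continuousAt (1 : Bˣ)
    simpa using this
  have := h1.tendsto
  simp only [zero_smul, sub_zero, Ring.inverse_one] at this
  exact this.mono_left nhdsWithin_le_nhds

lemma pow_mem_of_resolvent {B : Type*} [NormedRing B] [NormedAlgebra ℂ B] [CompleteSpace B] (S : B)
    (V : Submodule ℂ B) (hV : IsClosed (V : Set B)) (R : ℝ) (hR : 0 < R)
    (hu : ∀ c : ℂ, ‖c‖ < R → IsUnit (1 - c • S))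
    (h : ∀ c : ℂ, ‖c‖ < R → Ring.inverse (1 - c • S) ∈ V) (n : ℕ) : S ^ n ∈ V := by
  have hev : ∀ᶠ c : ℂ in nhdsWithin 0 {0}ᶜ, c ≠ 0 ∧ ‖c‖ < R := by
    filter_upwards [self_mem_nhdsWithin, mem_nhdsWithin_of_mem_nhds (Metric.ball_mem_nhds (0 : ℂ) hR)]
      with c h1 h2
    exact ⟨h1, by simpa using h2⟩
  have key : ∀ n : ℕ, ∀ c : ℂ, c ≠ 0 → ‖c‖ < R → S ^ n * Ring.inverse (1 - c • S) ∈ V := by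
    have lim : ∀ n : ℕ, (∀ c : ℂ, c ≠ 0 → ‖c‖ < R → S ^ n * Ring.inverse (1 - c • S) ∈ V) → S ^ n ∈ V := by
      intro n hn
      have h1 := (resolvent_lim S).const_mul (S ^ n)
      rw [mul_one] at h1
      refine hV.mem_of_tendsto h1 ?_
      filter_upwards [hev] with c hc
      exact hn c hc.1 hc.2
    intro n
    induction n with
    | zero => intro c _ h2; simpa using h c h2
    | succ k ih =>
      intro c h1 h2
      have e : S ^ (k + 1) * Ring.inverse (1 - c • S) =
          c⁻¹ • (S ^ k * Ring.inverse (1 - c • S) - S ^ k) := by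
        have h3 := Ring.mul_inverse_cancel _ (hu c h2)
        have h4 : S ^ k * ((1 - c • S) * Ring.inverse (1 - c • S)) = S ^ k := by rw [h3, mul_one]
        rw [sub_mul, one_mul, mul_sub, smul_mul_assoc, mul_smul_comm, ← mul_assoc, ← pow_succ] at h4
        have h5 := sub_eq_iff_eq_add'.1 h4
        rw [h5, add_sub_cancel_right, smul_smul, inv_mul_cancel₀ h1, one_smul]
      rw [e]
      exact V.smul_mem _ (V.sub_mem (ih c h1 h2) (lim k ih))
  have h1 := (resolvent_lim S).const_mul (S ^ n)
  rw [mul_one] at h1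
  refine hV.mem_of_tendsto h1 ?_
  filter_upwards [hev] with c hc
  exact key n c hc.1 hc.2

lemma resolvent_mem_of_pow {B : Type*} [NormedRing B] [NormedAlgebra ℂ B] [CompleteSpace B] (S : B)
    (V : Submodule ℂ B) (hV : IsClosed (V : Set B)) (h : ∀ n : ℕ, S ^ n ∈ V)
    (c : ℂ) (hc : ‖c • S‖ < 1) : Ring.inverse (1 - c • S) ∈ V := by
  have e : Ring.inverse (1 - c • S) = ∑' i : ℕ, (c • S) ^ i := NormedRing.inverse_one_sub _ hc
  rw [e]
  have hs := (summable_geometric_of_norm_lt_one hc).hasSum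
  refine hV.mem_of_tendsto hs (Eventually.of_forall fun s => V.sum_mem fun i _ => ?_)
  rw [smul_pow]
  exact V.smul_mem _ (h i)

lemma exists_functional (h : Tc → ℂ) (hm : AEStronglyMeasurable h m) (hb : ∀ᵐ θ ∂m, ‖h θ‖ ≤ 1) :
    ∃ l : L2 →L[ℂ] ℂ, ∀ F : L2, l F = ∫ θ, h θ * (F : Tc → ℂ) θ ∂m := by
  have hM : MemLp (fun θ => conj (h θ)) 2 m := by
    refine MemLp.of_bound (Complex.continuous_conj.comp_aestronglyMeasurable hm) 1 ?_
    filter_upwards [hb] with θ hθ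
    simpa using hθ
  refine ⟨innerSL ℂ hM.toLp, fun F => ?_⟩
  rw [innerSL_apply_apply, L2.inner_def]
  refine integral_congr_ae ?_
  filter_upwards [hM.coeFn_toLp] with θ hθ
  rw [hθ]
  simp [mul_comm]

lemma mul_int {h : Tc → ℂ} (hm : AEStronglyMeasurable h m) (hb : ∀ᵐ θ ∂m, ‖h θ‖ ≤ 1) (F : L2) :
    Integrable (fun θ => h θ * (F : Tc → ℂ) θ) m :=
  Integrable.bdd_mul (c := 1) ((Lp.memLp F).integrable (by norm_num)) hm hb

lemma fc_m (f : Tc → ℂ) (n : ℤ) : fourierCoeff f n = ∫ θ, fourier (-n) θ * f θ ∂m := rfl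

lemma fourier_le (n : ℤ) : ∀ᵐ θ ∂m, ‖(fourier n : Tc → ℂ) θ‖ ≤ 1 :=
  Eventually.of_forall fun θ => by rw [fourier_apply]; exact (Circle.norm_coe _).le

lemma fourier_meas (n : ℤ) : AEStronglyMeasurable (fourier n : Tc → ℂ) m :=
  (fourier n).continuous.aestronglyMeasurable

lemma fourier_mul_int {f : Tc → ℂ} (hf : Integrable f m) (n : ℤ) :
    Integrable (fun θ => fourier n θ * f θ) m :=
  Integrable.bdd_mul (c := 1) hf (fourier_meas n) (fourier_le n)

lemma conj_meas {h : Tc → ℂ} (hm : AEStronglyMeasurable h m) :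
    AEStronglyMeasurable (fun θ => conj (h θ)) m :=
  Complex.continuous_conj.comp_aestronglyMeasurable hm

lemma conj_le {h : Tc → ℂ} (hb : ∀ᵐ θ ∂m, ‖h θ‖ ≤ 1) : ∀ᵐ θ ∂m, ‖conj (h θ)‖ ≤ 1 := by
  filter_upwards [hb] with θ hθ
  simpa using hθ

lemma exists_fcfun (h : Tc → ℂ) (hm : AEStronglyMeasurable h m) (hb : ∀ᵐ θ ∂m, ‖h θ‖ ≤ 1) (n : ℤ) :
    ∃ l : L2 →L[ℂ] ℂ, ∀ F : L2, l F = fourierCoeff (fun θ => h θ * (F : Tc → ℂ) θ) n := by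
  obtain ⟨l, hl⟩ := exists_functional (fun θ => fourier (-n) θ * h θ) ((fourier_meas _).mul hm) (by
    filter_upwards [hb, fourier_le (-n)] with θ h1 h2
    rw [norm_mul]; exact mul_le_one₀ h2 (norm_nonneg _) h1)
  refine ⟨l, fun F => ?_⟩
  rw [hl, fc_m]
  simp only [mul_assoc]

lemma fc_sub {f g : Tc → ℂ} (hf : Integrable f m) (hg : Integrable g m) (n : ℤ) :
    fourierCoeff (fun θ => f θ - g θ) n = fourierCoeff f n - fourierCoeff g n := by
  simp only [fc_m, mul_sub]
  exact integral_sub (fourier_mul_int hf _) (fourier_mul_int hg _)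

lemma fc_add {f g : Tc → ℂ} (hf : Integrable f m) (hg : Integrable g m) (n : ℤ) :
    fourierCoeff (fun θ => f θ + g θ) n = fourierCoeff f n + fourierCoeff g n := by
  simp only [fc_m, mul_add]
  exact integral_add (fourier_mul_int hf _) (fourier_mul_int hg _)

lemma fc_congr {f g : Tc → ℂ} (h : f =ᵐ[m] g) (n : ℤ) : fourierCoeff f n = fourierCoeff g n := by
  simp only [fc_m]
  refine integral_congr_ae ?_
  filter_upwards [h] with θ hθ
  rw [hθ]

lemma fc_shift (f : Tc → ℂ) (n : ℤ) :
    fourierCoeff (fun θ => bd θ * f θ) n = fourierCoeff f (n - 1) := by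
  simp only [fc_m]
  congr 1; ext θ
  have h1 : bd θ = fourier 1 θ := by rw [fourier_one]; rfl
  rw [h1, ← mul_assoc, ← fourier_add]
  congr 3; ring

lemma Hb_char (P : BPair) : ∃ (ι : Type) (l : ι → (L2 →L[ℂ] ℂ)) (l' : ι → (L2 →L[ℂ] ℂ)),
    ∀ p : HbP, p ∈ HbSet P ↔ ∀ i, l i (fst2 p) - l' i (snd2 p) = 0 := by
  choose e he using fun n => exists_fcfun (fun _ => 1) aestronglyMeasurable_const
    (Eventually.of_forall fun _ => by simp) n
  choose lb hlb using fun n => exists_fcfun _ (conj_meas (bs_meas P)) (conj_le (bs_le P)) n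
  choose la hla using fun n => exists_fcfun _ (conj_meas (as_meas P)) (conj_le (as_le P)) n
  refine ⟨{n : ℤ // n < 0} ⊕ {n : ℤ // n < 0} ⊕ {n : ℤ // 0 ≤ n},
    Sum.elim (fun n => e n) (Sum.elim 0 (fun n => lb n)),
    Sum.elim 0 (Sum.elim (fun n => e n) (fun n => la n)), fun p => ?_⟩
  simp only [Sum.forall, Sum.elim_inl, Sum.elim_inr, Subtype.forall, HbSet, HbMem, H2, mem_ofPred_eq,
    he, hlb, hla, Pi.zero_apply, zero_apply, sub_zero, zero_sub, neg_eq_zero, one_mul]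
  have : ∀ n, fourierCoeff (fun θ => conj (P.bs θ) * (fst2 p : Tc → ℂ) θ
      - conj (P.as' θ) * (snd2 p : Tc → ℂ) θ) n = _ := fun n =>
    fc_sub (mul_int (conj_meas (bs_meas P)) (conj_le (bs_le P)) (fst2 p))
      (mul_int (conj_meas (as_meas P)) (conj_le (as_le P)) (snd2 p)) n
  simp only [this]

lemma fst2_add (p q : HbP) : fst2 (p + q) = fst2 p + fst2 q := rfl
lemma snd2_add (p q : HbP) : snd2 (p + q) = snd2 p + snd2 q := rfl
lemma fst2_sub (p q : HbP) : fst2 (p - q) = fst2 p - fst2 q := rfl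
lemma fst2_smul (c : ℂ) (p : HbP) : fst2 (c • p) = c • fst2 p := rfl
lemma snd2_smul (c : ℂ) (p : HbP) : snd2 (c • p) = c • snd2 p := rfl
lemma fst2_zero : fst2 (0 : HbP) = 0 := rfl
lemma snd2_zero : snd2 (0 : HbP) = 0 := rfl

lemma fst2_cont : Continuous fst2 :=
  continuous_fst.comp (WithLp.prod_continuous_ofLp 2 L2 L2)
lemma snd2_cont : Continuous snd2 :=
  continuous_snd.comp (WithLp.prod_continuous_ofLp 2 L2 L2)

def Hb (P : BPair) : Submodule ℂ HbP where
  carrier := HbSet P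
  add_mem' := by
    obtain ⟨ι, l, l', h⟩ := Hb_char P
    intro p q hp hq
    rw [h] at *
    intro i
    rw [fst2_add, snd2_add, map_add, map_add]
    linear_combination hp i + hq i
  zero_mem' := by
    obtain ⟨ι, l, l', h⟩ := Hb_char P
    rw [h]
    intro i
    rw [fst2_zero, snd2_zero, map_zero, map_zero, sub_zero]
  smul_mem' := by
    obtain ⟨ι, l, l', h⟩ := Hb_char P
    intro c p hp
    rw [h] at *
    intro i
    rw [fst2_smul, snd2_smul, map_smul, map_smul, smul_eq_mul, smul_eq_mul]
    linear_combination c * hp i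

lemma Hb_closed (P : BPair) : IsClosed (Hb P : Set HbP) := by
  obtain ⟨ι, l, l', h⟩ := Hb_char P
  have : (Hb P : Set HbP) = ⋂ i, {p | l i (fst2 p) - l' i (snd2 p) = 0} := by
    ext p
    rw [mem_iInter]
    exact h p
  rw [this]
  refine isClosed_iInter fun i => isClosed_eq ?_ continuous_const
  exact ((l i).continuous.comp fst2_cont).sub ((l' i).continuous.comp snd2_cont)

instance (P : BPair) : CompleteSpace (Hb P) := (Hb_closed P).completeSpace_coe

lemma bd_memLp (F : L2) : MemLp (fun θ => bd θ * (F : Tc → ℂ) θ) 2 m := by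
  refine (Lp.memLp F).of_le (bd_cont.aestronglyMeasurable.mul (Lp.aestronglyMeasurable F)) ?_
  exact Eventually.of_forall fun θ => by rw [norm_mul, bd_norm, one_mul]

lemma shift_exists (P : BPair) (p : HbP) (hp : p ∈ HbSet P) :
    ∃ q, MulRep P (fun θ => bd θ) p q := by
  obtain ⟨hF, hG, hr⟩ := hp
  set F := fst2 p
  set G := snd2 p
  have iF : Integrable (F : Tc → ℂ) m := (Lp.memLp F).integrable (by norm_num)
  set D : Tc → ℂ := fun θ => conj (P.bs θ) * (F : Tc → ℂ) θ - conj (P.as' θ) * (G : Tc → ℂ) θ with hD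
  have iD : Integrable D m := (mul_int (conj_meas (bs_meas P)) (conj_le (bs_le P)) F).sub
      (mul_int (conj_meas (as_meas P)) (conj_le (as_le P)) G)
  have ha0 : conj (P.a 0) ≠ 0 := by
    obtain ⟨r, h0, h1⟩ := P.a0_pos
    rw [h1]; simpa using h0.ne'
  set c : ℂ := fourierCoeff D (-1) / conj (P.a 0) with hc
  have hMG : MemLp (fun θ => bd θ * (G : Tc → ℂ) θ + c) 2 m := (bd_memLp G).add (memLp_const c)
  have eF := (bd_memLp F).coeFn_toLp
  have eG := hMG.coeFn_toLp
  refine ⟨(WithLp.equiv 2 (L2 × L2)).symm ((bd_memLp F).toLp, hMG.toLp), ⟨?_, ?_, ?_⟩, ?_⟩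
  · intro n hn
    change fourierCoeff ((bd_memLp F).toLp : Tc → ℂ) n = 0
    rw [fc_congr eF, fc_shift]
    exact hF _ (by omega)
  · intro n hn
    change fourierCoeff (hMG.toLp : Tc → ℂ) n = 0
    rw [fc_congr eG, fc_add ((bd_memLp G).integrable (by norm_num)) (integrable_const c), fc_shift,
      hG _ (by omega), zero_add]
    have : (fun _ : Tc => c) = fun θ => c * (fourier 0 : C(Tc, ℂ)) θ := by ext θ; simp
    rw [this, fourierCoeff.const_mul, fourierCoeff_fourier]
    simp [hn.ne]
  · intro n hn
    change fourierCoeff (fun θ => conj (P.bs θ) * ((bd_memLp F).toLp : Tc → ℂ) θ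
      - conj (P.as' θ) * (hMG.toLp : Tc → ℂ) θ) n = 0
    have e : (fun θ => conj (P.bs θ) * ((bd_memLp F).toLp : Tc → ℂ) θ
      - conj (P.as' θ) * (hMG.toLp : Tc → ℂ) θ) =ᵐ[m] fun θ => bd θ * D θ - c * conj (P.as' θ) := by
      filter_upwards [eF, eG] with θ h1 h2
      rw [h1, h2, hD]; ring
    have ia : Integrable (fun θ => conj (P.as' θ)) m :=
      Integrable.of_bound (conj_meas (as_meas P)) 1 (conj_le (as_le P))
    have ib : Integrable (fun θ => bd θ * D θ) m :=
      Integrable.bdd_mul (c := 1) iD bd_cont.aestronglyMeasurable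
        (Eventually.of_forall fun θ => (bd_norm θ).le)
    rw [fc_congr e, fc_sub ib (ia.const_mul c), fc_shift, fourierCoeff.const_mul]
    obtain ⟨k, rfl⟩ := Int.eq_ofNat_of_zero_le hn
    rw [as_fc]
    rcases Nat.eq_zero_or_pos k with rfl | hk
    · simp only [Nat.cast_zero, zero_sub, pow_zero, one_mul, hc]
      rw [div_mul_cancel₀ _ ha0, sub_self]
    · rw [zero_pow hk.ne']
      simp only [zero_mul, map_zero, mul_zero, sub_zero]
      exact hr _ (by omega)
  · exact eF

lemma MulRep_sub {P : BPair} {φ ψ : Tc → ℂ} {p q q' : HbP} (h : MulRep P φ p q) (h' : MulRep P ψ p q') :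
    MulRep P (φ - ψ) p (q - q') := by
  refine ⟨(Hb P).sub_mem h.1 h'.1, ?_⟩
  rw [fst2_sub]
  filter_upwards [Lp.coeFn_sub (fst2 q) (fst2 q'), h.2, h'.2] with θ h1 h2 h3
  rw [h1, Pi.sub_apply, h2, h3, Pi.sub_apply, sub_mul]

lemma rep_unique {P : BPair} {N : ℝ} (hN : ShiftBound P N) {ψ : Tc → ℂ} {p q q' : HbP}
    (h : MulRep P ψ p q) (h' : MulRep P ψ p q') : q = q' := by
  have h1 := MulRep_sub h h'
  have h2 : MulRep P (fun θ => bd θ) 0 (q - q') := by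
    refine ⟨h1.1, ?_⟩
    rw [fst2_zero]
    filter_upwards [h1.2, Lp.coeFn_zero ℂ 2 m] with θ h2 h3
    rw [h2, h3]; simp
  have h3 := hN.2 0 _ (Hb P).zero_mem h2
  rw [norm_zero, mul_zero] at h3
  exact sub_eq_zero.1 (norm_le_zero_iff.1 h3)

/-- A Banach space isometrically identified with `H(b)`. -/
structure HModel (P : BPair) (X : Type) [NormedAddCommGroup X] [NormedSpace ℂ X] where
  J : X →ₗ[ℂ] HbP
  norm_J : ∀ x, ‖J x‖ = ‖x‖
  mem_J : ∀ x, J x ∈ HbSet P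
  surj_J : ∀ p ∈ HbSet P, ∃ x, J x = p

section model

variable {P : BPair} {X : Type} [NormedAddCommGroup X] [NormedSpace ℂ X] {M : HModel P X}

/-- `T` acts on `H(b)` as multiplication by `ψ`. -/
def MRep (M : HModel P X) (ψ : Tc → ℂ) (T : X →L[ℂ] X) : Prop := ∀ x : X, MulRep P ψ (M.J x) (M.J (T x))

lemma exists_shift (M : HModel P X) (N : ℝ) (hN : ShiftBound P N) :
    ∃ S : X →L[ℂ] X, ‖S‖ ≤ N ∧ MRep M bd S := by
  have ex : ∀ x : X, ∃ y : X, MulRep P bd (M.J x) (M.J y) := by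
    intro x
    obtain ⟨q, hq⟩ := shift_exists P (M.J x) (M.mem_J x)
    obtain ⟨y, rfl⟩ := M.surj_J q hq.1
    exact ⟨y, hq⟩
  choose s hs using ex
  have inj : ∀ x y : X, M.J x = M.J y → x = y := by
    intro x y h
    rw [← sub_eq_zero, ← norm_eq_zero, ← M.norm_J, map_sub, h, sub_self, norm_zero]
  let L : X →ₗ[ℂ] X :=
    { toFun := s
      map_add' := by
        intro p q
        refine inj _ _ (rep_unique hN (hs (p + q)) ⟨M.mem_J _, ?_⟩)
        rw [map_add, map_add, fst2_add, fst2_add]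
        filter_upwards [Lp.coeFn_add (fst2 (M.J (s p))) (fst2 (M.J (s q))),
          Lp.coeFn_add (fst2 (M.J p)) (fst2 (M.J q)), (hs p).2, (hs q).2] with θ h1 h2 h3 h4
        rw [h1, h2, Pi.add_apply, Pi.add_apply, h3, h4, mul_add]
      map_smul' := by
        intro c p
        refine inj _ _ (rep_unique hN (hs (c • p)) ⟨M.mem_J _, ?_⟩)
        rw [RingHom.id_apply, map_smul, map_smul, fst2_smul, fst2_smul]
        filter_upwards [Lp.coeFn_smul c (fst2 (M.J (s p))), Lp.coeFn_smul c (fst2 (M.J p)),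
          (hs p).2] with θ h1 h2 h3
        rw [h1, h2, Pi.smul_apply, Pi.smul_apply, h3, smul_eq_mul, smul_eq_mul]; ring }
  have hb : ∀ x, ‖L x‖ ≤ N * ‖x‖ := fun x => by
    have := hN.2 _ _ (M.mem_J x) (hs x)
    rwa [M.norm_J, M.norm_J] at this
  exact ⟨L.mkContinuous N hb, L.mkContinuous_norm_le hN.1 _, fun p => hs p⟩

lemma MRep_add {φ ψ : Tc → ℂ} {T U : X →L[ℂ] X} (h : MRep M φ T) (h' : MRep M ψ U) :
    MRep M (φ + ψ) (T + U) := by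
  intro p
  refine ⟨M.mem_J _, ?_⟩
  rw [ContinuousLinearMap.add_apply, map_add, fst2_add]
  filter_upwards [Lp.coeFn_add (fst2 (M.J (T p))) (fst2 (M.J (U p))), (h p).2, (h' p).2] with θ h1 h2 h3
  rw [h1, Pi.add_apply, h2, h3, Pi.add_apply, add_mul]

lemma MRep_smul {φ : Tc → ℂ} {T : X →L[ℂ] X} (c : ℂ) (h : MRep M φ T) :
    MRep M (c • φ) (c • T) := by
  intro p
  refine ⟨M.mem_J _, ?_⟩
  rw [ContinuousLinearMap.smul_apply, map_smul, fst2_smul]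
  filter_upwards [Lp.coeFn_smul c (fst2 (M.J (T p))), (h p).2] with θ h1 h2
  rw [h1, Pi.smul_apply, h2, Pi.smul_apply, smul_eq_mul, smul_eq_mul, mul_assoc]

lemma MRep_zero : MRep M 0 0 := by
  intro p
  refine ⟨M.mem_J _, ?_⟩
  rw [ContinuousLinearMap.zero_apply, map_zero, fst2_zero]
  filter_upwards [Lp.coeFn_zero ℂ 2 m] with θ h1
  rw [h1]; simp

lemma MRep_pow {S : X →L[ℂ] X} (h : MRep M bd S) (n : ℕ) :
    MRep M (fun θ => bd θ ^ n) (S ^ n) := by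
  induction n with
  | zero =>
    intro p
    refine ⟨M.mem_J _, ?_⟩
    rw [pow_zero, ContinuousLinearMap.one_apply]
    exact Eventually.of_forall fun θ => by simp
  | succ k ih =>
    intro p
    refine ⟨M.mem_J _, ?_⟩
    have e : (S ^ (k + 1)) p = (S ^ k) (S p) := by rw [pow_succ]; rfl
    rw [e]
    filter_upwards [(ih (S p)).2, (h p).2] with θ h1 h2
    rw [h1, h2, pow_succ, mul_assoc]

lemma MRep_ker {S : X →L[ℂ] X} (h : MRep M bd S) (μ : ℂ) (hμ : μ ∈ uDisc)
    (hu : IsUnit (1 - (conj μ) • S)) :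
    MRep M (fun θ => ker μ (bd θ)) (Ring.inverse (1 - (conj μ) • S)) := by
  intro p
  set T := Ring.inverse (1 - (conj μ) • S) with hT
  refine ⟨M.mem_J _, ?_⟩
  have h1 : (1 - (conj μ) • S) * T = 1 := Ring.mul_inverse_cancel _ hu
  have h2 : T p - (conj μ) • S (T p) = p := by
    have := congrArg (fun A : X →L[ℂ] X => A p) h1
    exact this
  have h3 : fst2 (M.J p) = fst2 (M.J (T p)) - (conj μ) • fst2 (M.J (S (T p))) := by
    rw [← fst2_smul, ← fst2_sub, ← map_smul, ← map_sub, h2]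
  filter_upwards [(h (T p)).2, Lp.coeFn_sub (fst2 (M.J (T p))) ((conj μ) • fst2 (M.J (S (T p)))),
    Lp.coeFn_smul (conj μ) (fst2 (M.J (S (T p))))] with θ a1 a2 a3
  rw [h3, a2, Pi.sub_apply, a3, Pi.smul_apply, a1, smul_eq_mul, _root_.ker]
  have hne : 1 - conj μ * bd θ ≠ 0 := by
    intro h0
    have := congrArg norm (sub_eq_zero.1 h0)
    rw [norm_mul, bd_norm, Complex.norm_conj] at this
    have h5 : ‖μ‖ < 1 := by simpa [uDisc] using hμ
    simp at this; linarith
  field_simp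

lemma span_lift {A : Set (Tc → ℂ)} {B : Set (X →L[ℂ] X)}
    (h : ∀ ψ ∈ A, ∃ T ∈ B, MRep M ψ T) :
    ∀ g ∈ Submodule.span ℂ A, ∃ G ∈ Submodule.span ℂ B, MRep M g G := by
  intro g hg
  induction hg using Submodule.span_induction with
  | mem x hx =>
    obtain ⟨T, hT, hr⟩ := h x hx
    exact ⟨T, Submodule.subset_span hT, hr⟩
  | zero => exact ⟨0, Submodule.zero_mem _, MRep_zero⟩
  | add x y _ _ hx hy =>
    obtain ⟨T, hT, hr⟩ := hx
    obtain ⟨U, hU, hr'⟩ := hy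
    exact ⟨T + U, Submodule.add_mem _ hT hU, MRep_add hr hr'⟩
  | smul c x _ hx =>
    obtain ⟨T, hT, hr⟩ := hx
    exact ⟨c • T, Submodule.smul_mem _ c hT, MRep_smul c hr⟩

lemma span_lower {A : Set (Tc → ℂ)} {B : Set (X →L[ℂ] X)}
    (h : ∀ T ∈ B, ∃ ψ ∈ A, MRep M ψ T) :
    ∀ G ∈ Submodule.span ℂ B, ∃ g ∈ Submodule.span ℂ A, MRep M g G := by
  intro g hg
  induction hg using Submodule.span_induction with
  | mem x hx =>
    obtain ⟨T, hT, hr⟩ := h x hx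
    exact ⟨T, Submodule.subset_span hT, hr⟩
  | zero => exact ⟨0, Submodule.zero_mem _, MRep_zero⟩
  | add x y _ _ hx hy =>
    obtain ⟨T, hT, hr⟩ := hx
    obtain ⟨U, hU, hr'⟩ := hy
    exact ⟨T + U, Submodule.add_mem _ hT hU, MRep_add hr hr'⟩
  | smul c x _ hx =>
    obtain ⟨T, hT, hr⟩ := hx
    exact ⟨c • T, Submodule.smul_mem _ c hT, MRep_smul c hr⟩

lemma closure_transfer (M : HModel P X) {A A' : Set (Tc → ℂ)} {B B' : Set (X →L[ℂ] X)}
    (h : ∀ ψ ∈ A, ∃ T ∈ B, MRep M ψ T) (h' : ∀ T ∈ B', ∃ ψ ∈ A', MRep M ψ T)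
    (hB : ∀ T ∈ B, T ∈ (Submodule.span ℂ B').topologicalClosure) {φ : Tc → ℂ}
    (hφ : InMultClosure P A φ) : InMultClosure P A' φ := by
  intro ε hε
  obtain ⟨g, hg, hgn⟩ := hφ (ε / 2) (by linarith)
  obtain ⟨G, hG, hgG⟩ := span_lift h g hg
  have hG' : G ∈ (Submodule.span ℂ B').topologicalClosure := (Submodule.span_le.2 hB) hG
  obtain ⟨K, hK, hd⟩ := Metric.mem_closure_iff.1 hG' (ε / 2) (by linarith)
  obtain ⟨k, hk, hkK⟩ := span_lower h' K hK
  refine ⟨k, hk, fun p q hp hq => ?_⟩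
  have hr : MRep M (g - k) (G - K) := by
    have := MRep_add hgG (MRep_smul (-1) hkK)
    simpa [sub_eq_add_neg] using this
  obtain ⟨x, rfl⟩ := M.surj_J p hp
  have h1 := MulRep_sub hq (hr x)
  have e : φ - k - (g - k) = φ - g := by abel
  rw [e] at h1
  have h2 := hgn _ _ hp h1
  have h3 : ‖M.J ((G - K) x)‖ ≤ ε / 2 * ‖M.J x‖ := by
    rw [dist_eq_norm] at hd
    rw [M.norm_J, M.norm_J]
    exact (G - K).le_of_opNorm_le hd.le x
  have h4 : q = (q - M.J ((G - K) x)) + M.J ((G - K) x) := by abel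
  calc ‖q‖ ≤ ‖q - M.J ((G - K) x)‖ + ‖M.J ((G - K) x)‖ := by
        conv_lhs => rw [h4]
        exact norm_add_le _ _
    _ ≤ ε * ‖M.J x‖ := by linarith

lemma core_thm [CompleteSpace X] (M : HModel P X) (N : ℝ) (hSB : ShiftBound P N) (hpos : 0 < N)
    (φs : Tc → ℂ) :
    InMultClosure P {ψ : Tc → ℂ | ∃ n : ℕ, ψ = fun θ => (bd θ) ^ n} φs ↔
      InMultClosure P
        {ψ : Tc → ℂ | ∃ μ : ℂ, μ ∈ uDisc ∧ ‖μ‖ < 1 / N ∧ ψ = fun θ => ker μ (bd θ)} φs := by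
  obtain ⟨S, hSn, hS⟩ := exists_shift M N hSB
  have hlt : ∀ c : ℂ, ‖c‖ < 1 / N → ‖c • S‖ < 1 := by
    intro c hc
    rw [norm_smul]
    rw [lt_div_iff₀ hpos] at hc
    exact (mul_le_mul_of_nonneg_left hSn (norm_nonneg c)).trans_lt hc
  have hu : ∀ c : ℂ, ‖c‖ < 1 / N → IsUnit (1 - c • S) := fun c hc =>
    isUnit_one_sub_of_norm_lt_one (hlt c hc)
  let B : Set (X →L[ℂ] X) := Set.range (fun n : ℕ => S ^ n)
  let B' : Set (X →L[ℂ] X) :=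
    {T | ∃ μ : ℂ, μ ∈ uDisc ∧ ‖μ‖ < 1 / N ∧ T = Ring.inverse (1 - (conj μ) • S)}
  have hcn : ∀ μ : ℂ, ‖μ‖ < 1 / N → ‖conj μ‖ < 1 / N := fun μ h => by rwa [Complex.norm_conj]
  constructor
  · refine closure_transfer M (B := B) (B' := B') ?_ ?_ ?_
    · rintro ψ ⟨n, rfl⟩
      exact ⟨S ^ n, ⟨n, rfl⟩, MRep_pow hS n⟩
    · rintro T ⟨μ, h1, h2, rfl⟩
      exact ⟨_, ⟨μ, h1, h2, rfl⟩, MRep_ker hS μ h1 (hu _ (hcn μ h2))⟩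
    · rintro T ⟨n, rfl⟩
      refine pow_mem_of_resolvent S _ (Submodule.isClosed_topologicalClosure _) (min (1 / N) 1)
        (lt_min (by positivity) one_pos) (fun c hc => hu c (lt_of_lt_of_le hc (min_le_left _ _))) ?_ n
      intro c hc
      refine Submodule.le_topologicalClosure _ (Submodule.subset_span ⟨conj c, ?_, ?_, ?_⟩)
      · simpa using lt_of_lt_of_le hc (min_le_right _ _)
      · exact hcn c (lt_of_lt_of_le hc (min_le_left _ _))
      · rw [Complex.conj_conj]
  · refine closure_transfer M (B := B') (B' := B) ?_ ?_ ?_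
    · rintro ψ ⟨μ, h1, h2, rfl⟩
      exact ⟨_, ⟨μ, h1, h2, rfl⟩, MRep_ker hS μ h1 (hu _ (hcn μ h2))⟩
    · rintro T ⟨n, rfl⟩
      exact ⟨_, ⟨n, rfl⟩, MRep_pow hS n⟩
    · rintro T ⟨μ, h1, h2, rfl⟩
      refine resolvent_mem_of_pow S _ (Submodule.isClosed_topologicalClosure _) (fun n => ?_) _
        (hlt _ (hcn μ h2))
      exact Submodule.le_topologicalClosure _ (Submodule.subset_span ⟨n, rfl⟩)

end model

/-- The submodule model of `H(b)`. -/
def stdModel (P : BPair) : HModel P (Hb P) where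
  J := (Hb P).subtype
  norm_J := fun _ => rfl
  mem_J := fun x => x.2
  surj_J := fun p hp => ⟨⟨p, hp⟩, rfl⟩

lemma Hb_trivial {P : BPair} (hN : ShiftBound P 0) (q : HbP) (hq : q ∈ HbSet P) : ‖q‖ ≤ 0 := by
  obtain ⟨r, hr⟩ := shift_exists P q hq
  have h1 := hN.2 q r hq hr
  rw [zero_mul] at h1
  have h2 : r = 0 := norm_le_zero_iff.1 h1
  have h3 : MulRep P (fun θ => bd θ) 0 q := by
    refine ⟨hq, ?_⟩
    have h4 := hr.2
    rw [h2, fst2_zero] at h4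
    rw [fst2_zero]
    filter_upwards [h4, Lp.coeFn_zero ℂ 2 m] with θ a1 a2
    rw [a2] at a1 ⊢
    simp only [Pi.zero_apply, mul_zero] at a1 ⊢
    rcases mul_eq_zero.1 a1.symm with h | h
    · have := bd_norm θ
      rw [h] at this; simp at this
    · exact h
  simpa using hN.2 0 q (Hb P).zero_mem h3

/-- In the multiplier algebra `M(H(b))`, the closure of the linear span of
`{z^n : n ≥ 0}` equals the closure of the linear span of `{k_μ : |μ| < 1/‖S_b‖}`. -/
theorem stmt_5 (P : BPair) (N : ℝ) (hN : IsShiftNorm P N)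
    (φ : ℂ → ℂ) (φs : Tc → ℂ) (hφ : IsMult P φ φs) :
    InMultClosure P {ψ : Tc → ℂ | ∃ n : ℕ, ψ = fun θ => (bd θ) ^ n} φs ↔
      InMultClosure P
        {ψ : Tc → ℂ | ∃ μ : ℂ, μ ∈ uDisc ∧ ‖μ‖ < 1 / N ∧ ψ = fun θ => ker μ (bd θ)} φs := by
  obtain ⟨hSB, -⟩ := hN
  rcases hSB.1.eq_or_lt with h0 | hpos
  · subst h0
    have triv : ∀ (ψ : Tc → ℂ) (ε : ℝ), 0 < ε → MultNormLe P ψ ε := by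
      intro ψ ε hε p q hp hq
      exact (Hb_trivial hSB q hq.1).trans (by positivity)
    exact ⟨fun _ ε hε => ⟨0, Submodule.zero_mem _, triv _ ε hε⟩,
      fun _ ε hε => ⟨0, Submodule.zero_mem _, triv _ ε hε⟩⟩
  exact core_thm (stdModel P) N hSB hpos φs

end
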